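/- Let (X_t) be a very-weak martingale in a Hilbert space H (X_0 = 0 and E[X_{t+1} | X_t] = X_t for all t) with bounded increments ‖X_{t+1} − X_t‖ ≤ 1 almost surely. Then for every a > 0 and t ≥ 1, P(‖X_t‖ ≥ a) ≤ 2e² exp(−a²/(2t)). -/

import Mathlib

open MeasureTheory

theorem vwm_cosh_convex (z A B p q : ℝ) (hp : 0 ≤ p) (hq : 0 ≤ q) (hpq : p + q = 1)
    (h : z ^ 2 ≤ p * A ^ 2 + q * B ^ 2) :
    Real.cosh z ≤ p * Real.cosh A + q * Real.cosh B := by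
  refine hasSum_le (fun k => ?_) (Real.hasSum_cosh z)
    (((Real.hasSum_cosh A).mul_left p).add ((Real.hasSum_cosh B).mul_left q))
  have h1 : (z ^ 2) ^ k ≤ (p * A ^ 2 + q * B ^ 2) ^ k := pow_le_pow_left₀ (sq_nonneg z) h k
  have h2 := (convexOn_pow (𝕜 := ℝ) k).2 (x := A ^ 2) (sq_nonneg A) (y := B ^ 2) (sq_nonneg B)
    hp hq hpq
  simp only [smul_eq_mul] at h2
  have h3 := h1.trans h2
  simp only [pow_mul]
  have hf : (0 : ℝ) < ((2 * k).factorial : ℝ) := by positivity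
  rw [← mul_div_assoc, ← mul_div_assoc, ← add_div]
  exact div_le_div_of_nonneg_right h3 hf.le

theorem vwm_step {H : Type*} [NormedAddCommGroup H] [InnerProductSpace ℝ H]
    (l : ℝ) (x y : H) (hxy : ‖y - x‖ ≤ 1) :
    Real.cosh (l * ‖y‖) ≤ Real.cosh l * Real.cosh (l * ‖x‖) + Real.sinh l *
      (inner ℝ ((Real.sinh (l * ‖x‖) / ‖x‖) • x) y
        - inner ℝ ((Real.sinh (l * ‖x‖) / ‖x‖) • x) x) := by
  rw [← inner_sub_right, real_inner_smul_left]
  obtain ⟨d, rfl⟩ : ∃ d, y = x + d := ⟨y - x, by abel⟩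
  rw [add_sub_cancel_left] at hxy ⊢
  have hn : ‖x + d‖ ^ 2 = ‖x‖ ^ 2 + 2 * inner ℝ x d + ‖d‖ ^ 2 := norm_add_sq_real x d
  have hd2 : ‖d‖ ^ 2 ≤ 1 := by nlinarith [norm_nonneg d]
  have hu : |inner ℝ x d| ≤ ‖x‖ := (abs_real_inner_le_norm x d).trans
    (mul_le_of_le_one_right (norm_nonneg x) hxy)
  generalize inner ℝ x d = u at *
  rcases eq_or_lt_of_le (norm_nonneg x) with hx | hx
  · have hx0 : x = 0 := norm_eq_zero.1 hx.symm
    subst hx0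
    simp only [norm_zero, zero_add, mul_zero, Real.cosh_zero, Real.sinh_zero, zero_div, zero_mul,
      mul_one, add_zero]
    rw [Real.cosh_le_cosh, abs_mul, abs_norm]
    exact mul_le_of_le_one_right (abs_nonneg _) hxy
  · obtain ⟨hu1, hu2⟩ := abs_le.1 hu
    generalize ‖x‖ = r at *
    have key := vwm_cosh_convex (l * ‖x + d‖) (l * r + l) (l * r - l)
      ((1 + u / r) / 2) ((1 - u / r) / 2) ?_ ?_ (by ring) ?_
    · rw [Real.cosh_add, Real.cosh_sub] at key
      refine key.trans (le_of_eq ?_)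
      ring
    · have : -1 ≤ u / r := by rw [le_div_iff₀ hx]; linarith
      linarith
    · have : u / r ≤ 1 := by rw [div_le_iff₀ hx]; linarith
      linarith
    · have : (1 + u / r) / 2 * (l * r + l) ^ 2 + (1 - u / r) / 2 * (l * r - l) ^ 2
          = l ^ 2 * (r ^ 2 + 2 * u + 1) := by
        field_simp
        ring
      rw [this, mul_pow, hn]
      exact mul_le_mul_of_nonneg_left (by linarith) (sq_nonneg l)

/-- Hayes-type concentration for very-weak martingales in Hilbert space.
Let `(X_t)` be a very-weak martingale in a Hilbert space `H` (`X_0 = 0` and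
`E[X_{t+1} | X_t] = X_t`) with increments bounded by `1` almost surely.  Then for every `a > 0`
and `t ≥ 1`, `P(‖X_t‖ ≥ a) ≤ 2 e² exp(−a²/(2t))`. -/
theorem veryWeakMartingale_concentration
    {Ω : Type*} [MeasurableSpace Ω] (μ : Measure Ω) [IsProbabilityMeasure μ]
    {H : Type*} [NormedAddCommGroup H] [InnerProductSpace ℝ H] [CompleteSpace H]
    [MeasurableSpace H] [BorelSpace H]
    (X : ℕ → Ω → H)
    (hmeas : ∀ t, Measurable (X t)) (hint : ∀ t, Integrable (X t) μ)
    (h0 : ∀ ω, X 0 ω = 0)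
    (hmart : ∀ t, μ[X (t + 1) | MeasurableSpace.comap (X t) inferInstance] =ᵐ[μ] X t)
    (hbdd : ∀ t, ∀ᵐ ω ∂μ, ‖X (t + 1) ω - X t ω‖ ≤ 1) :
    ∀ a : ℝ, 0 < a → ∀ t : ℕ, 1 ≤ t →
      (μ {ω | a ≤ ‖X t ω‖}).toReal ≤
        2 * Real.exp 2 * Real.exp (-(a ^ 2) / (2 * t)) := by
  intro a ha t ht
  have hB : ∀ t, ∀ᵐ ω ∂μ, ‖X t ω‖ ≤ t := by
    intro t
    induction t with
    | zero => exact ae_of_all _ fun ω => by simp [h0 ω]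
    | succ n ih =>
      filter_upwards [ih, hbdd n] with ω h1 h2
      have := norm_add_le (X n ω) (X (n + 1) ω - X n ω)
      rw [add_sub_cancel] at this
      push_cast
      linarith
  have hci : ∀ (l : ℝ) (t : ℕ), Integrable (fun ω => Real.cosh (l * ‖X t ω‖)) μ := by
    intro l t
    refine Integrable.of_bound (C := Real.cosh (l * t)) ?_ ?_
    · exact (Real.continuous_cosh.comp_aestronglyMeasurable
        ((hint t).aestronglyMeasurable.norm.const_mul l))
    · filter_upwards [hB t] with ω h
      rw [Real.norm_eq_abs, abs_of_pos (Real.cosh_pos _), Real.cosh_le_cosh, abs_mul, abs_mul, abs_norm,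
        Nat.abs_cast]
      exact mul_le_mul_of_nonneg_left h (abs_nonneg l)
  have hstep : ∀ (l : ℝ) (t : ℕ), ∫ ω, Real.cosh (l * ‖X (t + 1) ω‖) ∂μ
      ≤ Real.cosh l * ∫ ω, Real.cosh (l * ‖X t ω‖) ∂μ := by
    intro l t
    have hm : MeasurableSpace.comap (X t) inferInstance ≤ (inferInstance : MeasurableSpace Ω) :=
      (hmeas t).comap_le
    let f : Ω → H := fun ω => (Real.sinh (l * ‖X t ω‖) / ‖X t ω‖) • X t ω
    have hXm : AEStronglyMeasurable[MeasurableSpace.comap (X t) inferInstance] (X t) μ :=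
      ⟨_, stronglyMeasurable_condExp, (hmart t).symm⟩
    have hfm : AEStronglyMeasurable[MeasurableSpace.comap (X t) inferInstance] f μ := by
      refine AEStronglyMeasurable.smul ?_ hXm
      have hg : Measurable (fun x : H => Real.sinh (l * ‖x‖) / ‖x‖) :=
        (Real.measurable_sinh.comp (measurable_norm.const_mul l)).div measurable_norm
      exact (hg.comp (comap_measurable (X t))).stronglyMeasurable.aestronglyMeasurable
    have hfb : ∀ᵐ ω ∂μ, ‖f ω‖ ≤ Real.cosh (l * t) := by
      filter_upwards [hB t] with ω h
      have h1 : ‖f ω‖ ≤ |Real.sinh (l * ‖X t ω‖)| := by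
        simp only [f, norm_smul, norm_div, Real.norm_eq_abs, abs_norm]
        rcases eq_or_ne ‖X t ω‖ 0 with h0 | h0
        · simp [h0]
        · rw [div_mul_cancel₀ _ h0]
      refine h1.trans ?_
      have h2 : |Real.sinh (l * ‖X t ω‖)| ≤ Real.cosh (l * ‖X t ω‖) :=
        abs_le.2 ⟨by linarith [Real.cosh_add_sinh (l * ‖X t ω‖), Real.exp_pos (l * ‖X t ω‖)],
          (Real.sinh_lt_cosh _).le⟩
      refine h2.trans ?_
      rw [Real.cosh_le_cosh, abs_mul, abs_mul, abs_norm, Nat.abs_cast]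
      exact mul_le_mul_of_nonneg_left h (abs_nonneg l)
    have hfi : ∀ s, Integrable (fun ω => inner ℝ (f ω) (X s ω)) μ := by
      intro s
      refine Integrable.of_bound (C := Real.cosh (l * t) * s)
        ((hfm.mono hm).inner (hint s).aestronglyMeasurable) ?_
      filter_upwards [hfb, hB s] with ω h1 h2
      exact (norm_inner_le_norm _ _).trans
        (mul_le_mul h1 h2 (norm_nonneg _) (Real.cosh_pos _).le)
    have hpull := condExp_bilin_of_aestronglyMeasurable_left (innerSL ℝ (E := H)) (g := X (t + 1))
      hfm (hfi (t + 1)) (hint (t + 1))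
    have heq : ∫ ω, inner ℝ (f ω) (X (t + 1) ω) ∂μ = ∫ ω, inner ℝ (f ω) (X t ω) ∂μ := by
      rw [← integral_condExp hm]
      refine integral_congr_ae ?_
      filter_upwards [hpull, hmart t] with ω h1 h2
      rw [h2] at h1
      exact h1
    have hle : ∫ ω, Real.cosh (l * ‖X (t + 1) ω‖) ∂μ ≤
        ∫ ω, (Real.cosh l * Real.cosh (l * ‖X t ω‖) + Real.sinh l *
          (inner ℝ (f ω) (X (t + 1) ω) - inner ℝ (f ω) (X t ω))) ∂μ := by
      refine integral_mono_ae (hci l (t + 1))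
        (((hci l t).const_mul _).add (((hfi (t + 1)).sub (hfi t)).const_mul _)) ?_
      filter_upwards [hbdd t] with ω h
      exact vwm_step l (X t ω) (X (t + 1) ω) h
    have hsubi : Integrable (fun ω => Real.sinh l *
        (inner ℝ (f ω) (X (t + 1) ω) - inner ℝ (f ω) (X t ω))) μ :=
      ((hfi (t + 1)).sub (hfi t)).const_mul _
    rw [integral_add ((hci l t).const_mul _) hsubi,
      integral_const_mul, integral_const_mul, integral_sub (hfi (t + 1)) (hfi t), heq] at hle
    simpa using hle
  have hpow : ∀ (l : ℝ) (t : ℕ), ∫ ω, Real.cosh (l * ‖X t ω‖) ∂μ ≤ Real.cosh l ^ t := by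
    intro l t
    induction t with
    | zero => simp [h0]
    | succ n ih =>
      rw [pow_succ']
      exact (hstep l n).trans (mul_le_mul_of_nonneg_left ih (Real.cosh_pos l).le)
  have htp : (0 : ℝ) < t := by exact_mod_cast ht
  set l : ℝ := a / t with hl
  have hlp : 0 < l := div_pos ha htp
  have hmarkov := mul_meas_ge_le_integral_of_nonneg
    (ae_of_all μ fun ω => (Real.cosh_pos (l * ‖X t ω‖)).le) (hci l t) (Real.cosh (l * a))
  have hsub : {ω | a ≤ ‖X t ω‖} ⊆ {ω | Real.cosh (l * a) ≤ Real.cosh (l * ‖X t ω‖)} := by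
    intro ω hω
    simp only [Set.mem_ofPred_eq] at hω ⊢
    rw [Real.cosh_le_cosh, abs_of_nonneg (by positivity), abs_of_nonneg (by positivity)]
    exact mul_le_mul_of_nonneg_left hω hlp.le
  have hP : (μ {ω | a ≤ ‖X t ω‖}).toReal ≤
      μ.real {ω | Real.cosh (l * a) ≤ Real.cosh (l * ‖X t ω‖)} := measureReal_mono hsub
  set P := (μ {ω | a ≤ ‖X t ω‖}).toReal with hPdef
  have hP0 : 0 ≤ P := ENNReal.toReal_nonneg
  have h1 : Real.cosh (l * a) * P ≤ Real.exp (l ^ 2 / 2 * t) := by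
    refine (mul_le_mul_of_nonneg_left hP (Real.cosh_pos _).le).trans
      (hmarkov.trans ((hpow l t).trans ?_))
    rw [mul_comm, Real.exp_nat_mul]
    exact pow_le_pow_left₀ (Real.cosh_pos l).le (Real.cosh_le_exp_half_sq l) t
  have h2 : Real.exp (l * a) / 2 ≤ Real.cosh (l * a) := by
    rw [Real.cosh_eq]
    linarith [Real.exp_pos (-(l * a))]
  have h3 : Real.exp (l * a) * P ≤ 2 * Real.exp (l ^ 2 / 2 * t) := by
    have := mul_le_mul_of_nonneg_right h2 hP0
    linarith
  have h4 : P ≤ 2 * Real.exp (-(a ^ 2) / (2 * t)) := by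
    have e1 : Real.exp (l ^ 2 / 2 * t) = Real.exp (l * a) * Real.exp (-(a ^ 2) / (2 * t)) := by
      rw [← Real.exp_add]
      congr 1
      rw [hl]
      field_simp
      ring
    rw [e1] at h3
    have := Real.exp_pos (l * a)
    refine le_of_mul_le_mul_left ?_ this
    linarith
  refine h4.trans ?_
  have h5 : (1 : ℝ) ≤ Real.exp 2 := Real.one_le_exp (by norm_num)
  refine mul_le_mul_of_nonneg_right ?_ (Real.exp_pos _).le
  linarith
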